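/- Green's hyperplane restriction theorem: Let k be an infinite field, R = k[x_1,…,x_r] with the standard grading, I ⊆ R a homogeneous ideal, and d ≥ 1 an integer. Set h_d = dim_k (R/I)_d. Then for a general linear form L ∈ R_1, the dimension h'_d = dim_k (R/(I + (L)))_d satisfies h'_d ≤ ((h_d)_{(d)})^{-1}_0. -/

import Mathlib

open MvPolynomial

/-- The degree-`d` graded component of `R/I` (the image of the space of
degree-`d` homogeneous polynomials in the quotient), as a `k`-submodule. -/
noncomputable def gradedPiece (k : Type*) [Field k] (r : ℕ)
    (I : Ideal (MvPolynomial (Fin r) k)) (d : ℕ) :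
    Submodule k (MvPolynomial (Fin r) k ⧸ I) :=
  Submodule.map (Ideal.Quotient.mkₐ k I).toLinearMap
    (homogeneousSubmodule (Fin r) k d)

/-- The Hilbert function of `R/I` in degree `d`. -/
noncomputable def hilb (k : Type*) [Field k] (r : ℕ)
    (I : Ideal (MvPolynomial (Fin r) k)) (d : ℕ) : ℕ :=
  Module.finrank k (gradedPiece k r I d)

/-- `I` is a homogeneous ideal. -/
def IsHomogIdeal {k : Type*} [Field k] {r : ℕ}
    (I : Ideal (MvPolynomial (Fin r) k)) : Prop :=
  ∀ f ∈ I, ∀ n : ℕ, homogeneousComponent n f ∈ I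

/-- `I` contains no nonzero linear forms. -/
def NoLinearForms {k : Type*} [Field k] {r : ℕ}
    (I : Ideal (MvPolynomial (Fin r) k)) : Prop :=
  ∀ f ∈ I, f.IsHomogeneous 1 → f = 0

/-- The dimension of the degree-`i` component of the socle of `R/I`. -/
noncomputable def socDim (k : Type*) [Field k] (r : ℕ)
    (I : Ideal (MvPolynomial (Fin r) k)) (i : ℕ) : ℕ :=
  Module.finrank k (Submodule.map (Ideal.Quotient.mkₐ k I).toLinearMap
    (homogeneousSubmodule (Fin r) k i ⊓
      ⨅ j : Fin r, Submodule.comap (LinearMap.mulLeft k (X j))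
        (Submodule.restrictScalars k I)))

/-- `R/I` is a standard graded artinian algebra:
`I` is homogeneous and `R/I` is finite-dimensional over `k`. -/
def StdArtinian (k : Type*) [Field k] (r : ℕ)
    (I : Ideal (MvPolynomial (Fin r) k)) : Prop :=
  IsHomogIdeal I ∧ Module.Finite k (MvPolynomial (Fin r) k ⧸ I)

/-- `R/I` has socle degree `e`: `e` is the largest degree with nonzero
Hilbert function. -/
def SocleDegree (k : Type*) [Field k] (r : ℕ)
    (I : Ideal (MvPolynomial (Fin r) k)) (e : ℕ) : Prop :=
  hilb k r I e ≠ 0 ∧ ∀ j : ℕ, e < j → hilb k r I j = 0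

/-- `R/I` is a standard graded artinian Gorenstein algebra of socle degree `e`:
the socle vanishes below degree `e` and is one-dimensional in degree `e`. -/
def Gorenstein (k : Type*) [Field k] (r e : ℕ)
    (I : Ideal (MvPolynomial (Fin r) k)) : Prop :=
  StdArtinian k r I ∧ SocleDegree k r I e ∧
    (∀ i : ℕ, i < e → socDim k r I i = 0) ∧ socDim k r I e = 1

/-- `R/I` is a standard graded artinian level algebra of socle degree `e`. -/
def LevelAlg (k : Type*) [Field k] (r e : ℕ)
    (I : Ideal (MvPolynomial (Fin r) k)) : Prop :=
  StdArtinian k r I ∧ SocleDegree k r I e ∧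
    (∀ i : ℕ, i < e → socDim k r I i = 0)

/-- The linear form with coefficient vector `c`. -/
noncomputable def linForm {k : Type*} [Field k] {r : ℕ} (c : Fin r → k) :
    MvPolynomial (Fin r) k :=
  ∑ i, C (c i) * X i

/-- A property `P` holds for a general linear form: there is a nonempty
(basic) Zariski-open subset of the space of linear forms on which `P` holds. -/
def Generically (k : Type*) [Field k] (r : ℕ)
    (P : MvPolynomial (Fin r) k → Prop) : Prop :=
  ∃ Q : MvPolynomial (Fin r) k, Q ≠ 0 ∧
    ∀ c : Fin r → k, eval c Q ≠ 0 → P (linForm c)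

/-- `R/I` has the weak Lefschetz property (socle degree `e`): multiplication
by some linear form has maximal rank from each degree `i < e` to degree `i+1`. -/
def WLP (k : Type*) [Field k] (r e : ℕ)
    (I : Ideal (MvPolynomial (Fin r) k)) : Prop :=
  ∃ L : MvPolynomial (Fin r) k, L.IsHomogeneous 1 ∧
    ∀ i : ℕ, i < e →
      Module.finrank k (Submodule.map
        (LinearMap.mulLeft k (Ideal.Quotient.mk I L)) (gradedPiece k r I i)) =
      min (hilb k r I i) (hilb k r I (i + 1))

/-- The largest `t` with `choose t i ≤ n`: the leading top in the
`i`-binomial expansion of `n`. -/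
noncomputable def binTop (n i : ℕ) : ℕ := sSup {t : ℕ | Nat.choose t i ≤ n}

/-- Auxiliary recursion computing `((n)_{(i)})⁻¹₀`, i.e. the sum
`C(n_i - 1, i) + C(n_{i-1} - 1, i-1) + ⋯ + C(n_j - 1, j)` where
`n_{(i)} = C(n_i, i) + ⋯ + C(n_j, j)` is the `i`-binomial expansion of `n`. -/
noncomputable def greenBoundAux : ℕ → ℕ → ℕ
  | 0, _ => 0
  | (i + 1), n =>
    if n = 0 then 0 else
      Nat.choose (binTop n (i + 1) - 1) (i + 1) +
        greenBoundAux i (n - Nat.choose (binTop n (i + 1)) (i + 1))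

/-- `greenBound n i = ((n)_{(i)})⁻¹₀`. -/
noncomputable def greenBound (n i : ℕ) : ℕ := greenBoundAux i n

theorem greenBoundAux_zero_right (d : ℕ) : greenBoundAux d 0 = 0 := by
  cases d <;> simp [greenBoundAux]

theorem binTop_choose_add {d t x : ℕ} (hx : x < t.choose d) :
    binTop (t.choose (d + 1) + x) (d + 1) = t := by
  refine IsGreatest.csSup_eq ⟨by simp, fun s hs => ?_⟩
  by_contra! hlt
  have h1 : (t + 1).choose (d + 1) ≤ s.choose (d + 1) := Nat.choose_le_choose _ hlt
  rw [Nat.choose_succ_succ'] at h1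
  simp only [Set.mem_ofPred_eq] at hs
  omega

theorem greenBoundAux_succ_choose_add {d t x : ℕ} (ht : d ≤ t) (hx : x < t.choose d) :
    greenBoundAux (d + 1) (t.choose (d + 1) + x) =
      (t - 1).choose (d + 1) + greenBoundAux d x := by
  obtain rfl | ht := ht.eq_or_lt
  · obtain rfl : x = 0 := by simpa using hx
    rw [Nat.choose_succ_self, Nat.choose_eq_zero_of_lt (by omega)]
    simp [greenBoundAux_zero_right]
  · have hpos : 0 < t.choose (d + 1) := Nat.choose_pos ht
    rw [greenBoundAux, if_neg (by omega), binTop_choose_add hx, Nat.add_sub_cancel_left]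

theorem greenBoundAux_choose {d t : ℕ} (hd : 1 ≤ d) (ht : d ≤ t) :
    greenBoundAux d (t.choose d) = (t - 1).choose d := by
  obtain ⟨d, rfl⟩ := Nat.exists_eq_add_of_le' hd
  simpa [greenBoundAux_zero_right] using
    greenBoundAux_succ_choose_add (x := 0) (by omega : d ≤ t) (Nat.choose_pos (by omega))

theorem greenBoundAux_succ_choose_add_of_le {d t x : ℕ} (hd : 1 ≤ d) (ht : d ≤ t)
    (hx : x ≤ t.choose d) :
    greenBoundAux (d + 1) (t.choose (d + 1) + x) =
      (t - 1).choose (d + 1) + greenBoundAux d x := by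
  obtain rfl | hx := hx.eq_or_lt
  · obtain ⟨t, rfl⟩ : ∃ s, t = s + 1 := ⟨t - 1, by omega⟩
    rw [greenBoundAux_choose hd ht, add_comm (Nat.choose _ _), ← Nat.choose_succ_succ',
      greenBoundAux_choose (by omega) (by omega), Nat.add_sub_cancel, Nat.add_sub_cancel,
      Nat.choose_succ_succ', add_comm]
  · exact greenBoundAux_succ_choose_add ht hx

theorem exists_eq_choose_add (d n : ℕ) :
    ∃ t x, d ≤ t ∧ x < t.choose d ∧ n = t.choose (d + 1) + x := by
  induction n with
  | zero => exact ⟨d, 0, le_rfl, by simp, by simp⟩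
  | succ n ih =>
    obtain ⟨t, x, ht, hx, rfl⟩ := ih
    by_cases h : x + 1 < t.choose d
    · exact ⟨t, x + 1, ht, h, rfl⟩
    · refine ⟨t + 1, 0, by omega, Nat.choose_pos (by omega), ?_⟩
      rw [Nat.choose_succ_succ']
      omega

theorem greenBoundAux_one (n : ℕ) : greenBoundAux 1 n = n - 1 := by
  obtain ⟨t, x, -, hx, rfl⟩ := exists_eq_choose_add 0 n
  rw [greenBoundAux_succ_choose_add (Nat.zero_le t) hx]
  simp_all [greenBoundAux]

theorem greenBoundAux_succ_bounds (d n : ℕ) :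
    greenBoundAux (d + 1) n ≤ greenBoundAux (d + 1) (n + 1) ∧
      greenBoundAux (d + 1) (n + 1) ≤ greenBoundAux (d + 1) n + 1 := by
  induction d generalizing n with
  | zero => simp only [zero_add, greenBoundAux_one]; omega
  | succ d ih =>
    obtain ⟨t, x, ht, hx, rfl⟩ := exists_eq_choose_add (d + 1) n
    rw [add_assoc _ x, greenBoundAux_succ_choose_add_of_le (by omega) ht hx.le,
      greenBoundAux_succ_choose_add_of_le (by omega) ht (show x + 1 ≤ _ from hx)]
    have := ih x
    omega

theorem monotone_greenBoundAux (d : ℕ) : Monotone (greenBoundAux (d + 1)) :=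
  monotone_nat_of_le_succ fun n => (greenBoundAux_succ_bounds d n).1

theorem add_greenBoundAux_le {d m n : ℕ} (h : m ≤ n) :
    m + greenBoundAux (d + 1) n ≤ n + greenBoundAux (d + 1) m := by
  induction n, h using Nat.le_induction with
  | base => exact le_rfl
  | succ n _ ih =>
    have := (greenBoundAux_succ_bounds d n).2
    omega

theorem greenBoundAux_lt_self {d n : ℕ} (hn : 0 < n) : greenBoundAux (d + 1) n < n := by
  have h1 : greenBoundAux (d + 1) 1 = 0 := by
    simpa using greenBoundAux_choose (by omega : 1 ≤ d + 1) le_rfl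
  have := add_greenBoundAux_le (d := d) (show 1 ≤ n from hn)
  omega

theorem greenBoundAux_add_greenBoundAux_lt (d : ℕ) {n : ℕ} (hn : 0 < n) :
    greenBoundAux (d + 1) (greenBoundAux (d + 1) n + 1) +
        greenBoundAux d (n - greenBoundAux (d + 1) n - 1) <
      greenBoundAux (d + 1) n + 1 := by
  induction d generalizing n with
  | zero =>
    rw [zero_add, greenBoundAux_one, greenBoundAux_one, greenBoundAux]
    omega
  | succ d ih =>
    obtain ⟨t, x, ht, hx, hn'⟩ := exists_eq_choose_add (d + 1) (n - 1)
    replace hn' : n = t.choose (d + 1 + 1) + (x + 1) := by omega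
    obtain ⟨t, rfl⟩ : ∃ s, t = s + 1 := ⟨t - 1, by omega⟩
    have hg : greenBoundAux (d + 1 + 1) n =
        t.choose (d + 1 + 1) + greenBoundAux (d + 1) (x + 1) := by
      rw [hn', greenBoundAux_succ_choose_add_of_le (by omega) ht hx, add_tsub_cancel_right]
    have hpas : (t + 1).choose (d + 1 + 1) = t.choose (d + 1) + t.choose (d + 1 + 1) :=
      Nat.choose_succ_succ' _ _
    have hpas' : (t + 1).choose (d + 1) = t.choose d + t.choose (d + 1) :=
      Nat.choose_succ_succ' _ _
    have htop : greenBoundAux (d + 1) ((t + 1).choose (d + 1)) = t.choose (d + 1) :=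
      greenBoundAux_choose (by omega) ht
    have hylt := greenBoundAux_lt_self (d := d) (show 0 < x + 1 by omega)
    have hyle : greenBoundAux (d + 1) (x + 1) ≤ t.choose (d + 1) :=
      htop ▸ monotone_greenBoundAux d hx
    have hsub := add_greenBoundAux_le (d := d) (show x + 1 ≤ _ from hx)
    have IH := ih (show 0 < x + 1 by omega)
    rw [hg]
    set y := greenBoundAux (d + 1) (x + 1)
    have hsub' : n - (t.choose (d + 1 + 1) + y) - 1 = t.choose (d + 1) + (x + 1 - y - 1) := by
      omega
    rw [hsub']
    obtain hy | hy := hyle.eq_or_lt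
    · have h1 : greenBoundAux (d + 1) 1 = 0 := by
        simpa using greenBoundAux_choose (by omega : 1 ≤ d + 1) le_rfl
      have h2 : greenBoundAux (d + 1 + 1) (t.choose (d + 1 + 1) + y + 1) = t.choose (d + 1 + 1) := by
        have := greenBoundAux_succ_choose_add_of_le (x := 1) (by omega) ht
          (Nat.choose_pos ht)
        rw [h1, hpas] at this
        rw [hy, add_comm (Nat.choose _ _)]
        simpa using this
      have h3 : greenBoundAux (d + 1) (t.choose (d + 1) + (x + 1 - y - 1)) ≤
          t.choose (d + 1) := htop ▸ monotone_greenBoundAux d (by omega)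
      omega
    · have hdt : d + 1 ≤ t := by
        by_contra! hlt
        rw [Nat.choose_eq_zero_of_lt hlt] at hy
        omega
      rw [add_assoc _ y, greenBoundAux_succ_choose_add_of_le (by omega) hdt (show y + 1 ≤ _ from hy),
        greenBoundAux_succ_choose_add (by omega) (by omega)]
      obtain ⟨t, rfl⟩ : ∃ s, t = s + 1 := ⟨t - 1, by omega⟩
      have : (t + 1).choose (d + 1 + 1) = t.choose (d + 1) + t.choose (d + 1 + 1) :=
        Nat.choose_succ_succ' _ _
      simp only [add_tsub_cancel_right]
      omega

theorem le_greenBoundAux_add {d a b : ℕ}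
    (h : b ≤ greenBoundAux (d + 1 + 1) b + greenBoundAux (d + 1) a) :
    b ≤ greenBoundAux (d + 1 + 1) (a + b) := by
  by_contra! hlt
  have h1 := greenBoundAux_add_greenBoundAux_lt (d + 1) (n := a + b) (by omega)
  have h2 := add_greenBoundAux_le (d := d + 1) (show _ + 1 ≤ b from hlt)
  have h3 : greenBoundAux (d + 1) a ≤
      greenBoundAux (d + 1) (a + b - greenBoundAux (d + 1 + 1) (a + b) - 1) :=
    monotone_greenBoundAux d (by omega)
  omega

open Module

section LinearAlgebra

variable {k U V : Type*} [Field k] [AddCommGroup U] [Module k U] [AddCommGroup V] [Module k V]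

theorem finrank_quotient_comap_add_finrank_quotient_sup_range [FiniteDimensional k V]
    (f : U →ₗ[k] V) (W : Submodule k V) :
    finrank k (U ⧸ W.comap f) + finrank k (V ⧸ (W ⊔ f.range)) = finrank k (V ⧸ W) := by
  have e1 := ((Submodule.quotEquivOfEq _ _ (by rw [LinearMap.ker_comp, W.ker_mkQ])).trans
    (W.mkQ.comp f).quotKerEquivRange : (U ⧸ W.comap f) ≃ₗ[k] _).finrank_eq
  have e2 := (Submodule.quotientQuotientEquivQuotientSup W f.range).finrank_eq
  rw [e1, ← e2, LinearMap.range_comp, add_comm]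
  exact Submodule.finrank_quotient_add_finrank _

theorem finrank_quotient_anti [FiniteDimensional k V] {W W' : Submodule k V} (h : W ≤ W') :
    finrank k (V ⧸ W') ≤ finrank k (V ⧸ W) := by
  have h1 := W.finrank_quotient_add_finrank
  have h2 := W'.finrank_quotient_add_finrank
  have := Submodule.finrank_mono h
  omega

theorem finrank_quotient_strictAnti [FiniteDimensional k V] {W W' : Submodule k V} (h : W < W') :
    finrank k (V ⧸ W') < finrank k (V ⧸ W) := by
  have h1 := W.finrank_quotient_add_finrank
  have h2 := W'.finrank_quotient_add_finrank
  have := Submodule.finrank_lt_finrank_of_lt h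
  omega

variable {r : ℕ}

/-- The rank of a linear family of maps is lower semicontinuous in the Zariski topology. -/
theorem exists_eval_ne_zero_and_finrank_range_le [FiniteDimensional k V]
    (μ : (Fin r → k) →ₗ[k] U →ₗ[k] V) (c₀ : Fin r → k) :
    ∃ Q : MvPolynomial (Fin r) k, MvPolynomial.eval c₀ Q ≠ 0 ∧
      ∀ c, MvPolynomial.eval c Q ≠ 0 → finrank k (μ c₀).range ≤ finrank k (μ c).range := by
  obtain ⟨g, hg⟩ := (μ c₀).rangeRestrict.exists_rightInverse_of_surjective
    (μ c₀).range_rangeRestrict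
  obtain ⟨φ, hφ⟩ := (μ c₀).range.subtype.exists_leftInverse_of_injective
    (Submodule.ker_subtype _)
  let F : (Fin r → k) →ₗ[k] End k (μ c₀).range :=
    (LinearMap.llcomp k _ _ _ φ) ∘ₗ (LinearMap.lcomp k V g) ∘ₗ μ
  have hF (c) : F c = φ ∘ₗ μ c ∘ₗ g := rfl
  have hdet (c) : (F c).det = (-1) ^ finrank k (μ c₀).range *
      MvPolynomial.eval c ((F.polyCharpoly (Pi.basisFun k (Fin r))).coeff 0) := by
    rw [LinearMap.det_eq_sign_charpoly_coeff,
      ← F.polyCharpoly_coeff_eval (Pi.basisFun k (Fin r))]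
    rfl
  have hF₀ : F c₀ = LinearMap.id := by
    rw [hF, ← hφ]
    ext x
    have hgx : μ c₀ (g x) = x := congrArg Subtype.val (LinearMap.congr_fun hg x)
    simp [hgx]
  refine ⟨(F.polyCharpoly (Pi.basisFun k (Fin r))).coeff 0, fun h => ?_, fun c hc => ?_⟩
  · have := hdet c₀
    simp [h, hF₀] at this
  · have hne : (F c).det ≠ 0 := by simp [hdet, hc]
    have hinj : Function.Injective (F c) :=
      (LinearMap.equivOfDetNeZero (F c) hne).injective
    have hrange : finrank k (F c).range = finrank k (μ c₀).range :=
      LinearMap.finrank_range_of_inj hinj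
    rw [← hrange, hF, LinearMap.range_comp]
    exact (Submodule.finrank_map_le _ _).trans
      (Submodule.finrank_mono (LinearMap.range_comp_le_range _ _))

theorem exists_eval_ne_zero_and_finrank_quotient_le [FiniteDimensional k V]
    (μ : (Fin r → k) →ₗ[k] U →ₗ[k] V) (W : Submodule k V) (c₀ : Fin r → k) :
    ∃ Q : MvPolynomial (Fin r) k, MvPolynomial.eval c₀ Q ≠ 0 ∧
      ∀ c, MvPolynomial.eval c Q ≠ 0 →
        finrank k (V ⧸ (W ⊔ (μ c).range)) ≤ finrank k (V ⧸ (W ⊔ (μ c₀).range)) := by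
  obtain ⟨Q, hQ₀, hQ⟩ := exists_eval_ne_zero_and_finrank_range_le
    ((LinearMap.llcomp k _ _ _ W.mkQ) ∘ₗ μ) c₀
  refine ⟨Q, hQ₀, fun c hc => ?_⟩
  have h (c) : finrank k (V ⧸ (W ⊔ (μ c).range)) + finrank k (W.mkQ ∘ₗ μ c).range =
      finrank k (V ⧸ W) := by
    rw [← (Submodule.quotientQuotientEquivQuotientSup W (μ c).range).finrank_eq,
      LinearMap.range_comp]
    exact Submodule.finrank_quotient_add_finrank _
  have h₀ := h c₀
  have h₁ := h c
  have := hQ c hc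
  change finrank k (W.mkQ ∘ₗ μ c₀).range ≤ finrank k (W.mkQ ∘ₗ μ c).range at this
  omega

end LinearAlgebra

/-- Green's hyperplane restriction inequality for a graded module over the polynomial ring,
generated in degree zero and given by the multiplication maps `μ d c : V d → V (d + 1)` of the
linear forms with coefficient vectors `c`. -/
theorem exists_finrank_quotient_sup_range_le {k : Type*} [Field k] [Infinite k] {r : ℕ}
    {V : ℕ → Type*} [∀ d, AddCommGroup (V d)] [∀ d, Module k (V d)]
    [∀ d, FiniteDimensional k (V d)]
    (μ : ∀ d, (Fin r → k) →ₗ[k] V d →ₗ[k] V (d + 1))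
    (hcomm : ∀ d c c' v, μ (d + 1) c (μ d c' v) = μ (d + 1) c' (μ d c v))
    (hspan : ∀ d, ⨆ c, (μ d c).range = ⊤) (d : ℕ) (W : Submodule k (V (d + 1))) :
    ∃ c, finrank k (V (d + 1) ⧸ (W ⊔ (μ d c).range)) ≤
      greenBoundAux (d + 1) (finrank k (V (d + 1) ⧸ W)) := by
  have hstrict (d) (W : Submodule k (V (d + 1))) (hW : W ≠ ⊤) :
      ∃ c, finrank k (V (d + 1) ⧸ (W ⊔ (μ d c).range)) < finrank k (V (d + 1) ⧸ W) := by
    by_contra! h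
    refine hW (top_le_iff.mp (hspan d ▸ iSup_le fun c => ?_))
    by_contra hc
    exact (finrank_quotient_strictAnti (left_lt_sup.mpr hc)).not_ge (h c)
  have htop (d) (c) : finrank k (V (d + 1) ⧸ ((⊤ : Submodule k (V (d + 1))) ⊔ (μ d c).range)) =
      0 := by
    rw [top_sup_eq]
    exact finrank_zero_of_subsingleton
  induction d with
  | zero =>
    obtain rfl | hW := eq_or_ne W ⊤
    · exact ⟨0, by simp [htop]⟩
    · obtain ⟨c, hc⟩ := hstrict 0 W hW
      exact ⟨c, (Nat.le_sub_one_of_lt hc).trans_eq (greenBoundAux_one _).symm⟩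
  | succ d ihd =>
    induction hn : finrank k (V (d + 1 + 1) ⧸ W) using Nat.strong_induction_on generalizing W with
    | _ n ihn =>
    obtain rfl | hW := eq_or_ne W ⊤
    · exact ⟨0, by simp [htop]⟩
    let codim (c) := finrank k (V (d + 1 + 1) ⧸ (W ⊔ (μ (d + 1) c).range))
    let c₀ := Function.argmin codim
    have hmin (c) : codim c₀ ≤ codim c := Function.argmin_le codim c
    have hlt : codim c₀ < n := by
      obtain ⟨c, hc⟩ := hstrict _ W hW
      exact (hmin c).trans_lt (hn ▸ hc)
    obtain ⟨c₁, hc₁⟩ := ihn _ hlt _ rfl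
    obtain ⟨Q₀, hQ₀, hQ₀'⟩ := exists_eval_ne_zero_and_finrank_quotient_le (μ (d + 1)) W c₀
    obtain ⟨Q₁, hQ₁, hQ₁'⟩ := exists_eval_ne_zero_and_finrank_quotient_le (μ (d + 1))
      (W ⊔ (μ (d + 1) c₀).range) c₁
    have hexists {Q Q' : MvPolynomial (Fin r) k} {c c' : Fin r → k}
        (hQ : MvPolynomial.eval c Q ≠ 0) (hQ' : MvPolynomial.eval c' Q' ≠ 0) :
        ∃ a, MvPolynomial.eval a (Q * Q') ≠ 0 := by
      by_contra! h
      have h0 : Q * Q' = 0 := MvPolynomial.funext (by simpa using h)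
      obtain rfl | rfl := mul_eq_zero.mp h0 <;> simp_all
    obtain ⟨a, ha⟩ := hexists hQ₀ hQ₁
    rw [map_mul, mul_ne_zero_iff] at ha
    obtain ⟨c₂, hc₂⟩ := ihd (W.comap (μ (d + 1) a))
    obtain ⟨Q₂, hQ₂, hQ₂'⟩ := exists_eval_ne_zero_and_finrank_quotient_le (μ d)
      (W.comap (μ (d + 1) a)) c₂
    obtain ⟨Q₃, hQ₃, hQ₃'⟩ := exists_eval_ne_zero_and_finrank_quotient_le (μ (d + 1))
      (W ⊔ (μ (d + 1) a).range) c₀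
    obtain ⟨a', ha'⟩ := hexists hQ₂ hQ₃
    rw [map_mul, mul_ne_zero_iff] at ha'
    have hcolon : W.comap (μ (d + 1) a) ⊔ (μ d a').range ≤
        (W ⊔ (μ (d + 1) a').range).comap (μ (d + 1) a) := by
      refine sup_le (Submodule.comap_mono le_sup_left) ?_
      rintro _ ⟨v, rfl⟩
      rw [Submodule.mem_comap, hcomm]
      exact Submodule.mem_sup_right ⟨_, rfl⟩
    have h1 := finrank_quotient_comap_add_finrank_quotient_sup_range (μ (d + 1) a) W
    have h2 := finrank_quotient_comap_add_finrank_quotient_sup_range (μ (d + 1) a)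
      (W ⊔ (μ (d + 1) a').range)
    have h3 := finrank_quotient_anti hcolon
    have h4 := hQ₂' a' ha'.1
    have h5 := hQ₃' a' ha'.2
    have h6 := hQ₁' a ha.2
    have h7 : codim a = codim c₀ := le_antisymm (hQ₀' a ha.1) (hmin a)
    have h8 := hmin a'
    rw [sup_right_comm] at h2 h6
    simp only [codim] at *
    rw [h7] at h1
    have h9 : n = finrank k (V (d + 1) ⧸ W.comap (μ (d + 1) a)) +
      finrank k (V (d + 1 + 1) ⧸ (W ⊔ (μ (d + 1) c₀).range)) := by omega
    refine ⟨c₀, ?_⟩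
    rw [h9]
    exact le_greenBoundAux_add (by omega)

section HomogeneousPolynomials

variable {k : Type*} [Field k] {r : ℕ}

instance (d : ℕ) : FiniteDimensional k (homogeneousSubmodule (Fin r) k d) :=
  Submodule.finiteDimensional_of_le (S₂ := restrictTotalDegree (Fin r) k d) fun p hp =>
    (mem_restrictTotalDegree _ _ p).mpr (IsHomogeneous.totalDegree_le hp)

theorem isHomogeneous_linForm (c : Fin r → k) : (linForm c).IsHomogeneous 1 :=
  IsHomogeneous.sum _ _ _ fun i _ => by
    simpa using (isHomogeneous_C (Fin r) (c i)).mul (isHomogeneous_X k i)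

theorem linForm_single (i : Fin r) : linForm (Pi.single i (1 : k)) = X i := by
  rw [linForm, Finset.sum_eq_single i] <;> simp +contextual

/-- Multiplication of forms of degree `d` by linear forms. -/
noncomputable def mulLinForm (k : Type*) [Field k] (r d : ℕ) :
    (Fin r → k) →ₗ[k] homogeneousSubmodule (Fin r) k d →ₗ[k]
      homogeneousSubmodule (Fin r) k (d + 1) :=
  LinearMap.mk₂ k
    (fun c p => ⟨linForm c * p, add_comm d 1 ▸ (isHomogeneous_linForm c).mul p.2⟩)
    (fun c c' p => Subtype.ext <| by
      simp [linForm, add_mul, Finset.sum_add_distrib])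
    (fun a c p => Subtype.ext <| by
      simp [linForm, Finset.smul_sum, smul_eq_C_mul, mul_assoc, Finset.sum_mul])
    (fun c p p' => Subtype.ext <| mul_add _ _ _)
    (fun a c p => Subtype.ext <| mul_smul_comm _ _ _)

@[simp]
theorem coe_mulLinForm (d : ℕ) (c : Fin r → k) (p : homogeneousSubmodule (Fin r) k d) :
    (mulLinForm k r d c p : MvPolynomial (Fin r) k) = linForm c * p := rfl

theorem iSup_range_mulLinForm (d : ℕ) : ⨆ c, (mulLinForm k r d c).range = ⊤ := by
  rw [← Submodule.map_injective_of_injective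
    (homogeneousSubmodule (Fin r) k (d + 1)).injective_subtype |>.eq_iff, Submodule.map_subtype_top]
  refine le_antisymm (Submodule.map_subtype_le _ _) fun p hp => ?_
  rw [p.as_sum]
  refine Submodule.sum_mem _ fun m hm => ?_
  have hdeg : m.degree = d + 1 := by
    rw [Finsupp.degree_eq_weight_one]
    exact hp (mem_support_iff.mp hm)
  obtain ⟨i, hi⟩ : ∃ i, m i ≠ 0 := by
    by_contra! h
    obtain rfl : m = 0 := Finsupp.ext h
    simp at hdeg
  obtain ⟨m', rfl⟩ : ∃ m', m = Finsupp.single i 1 + m' :=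
    exists_add_of_le (by simpa [Nat.one_le_iff_ne_zero] using hi)
  have hm' : monomial m' (coeff (Finsupp.single i 1 + m') p) ∈ homogeneousSubmodule (Fin r) k d := by
    refine isHomogeneous_monomial _ ?_
    rw [map_add, Finsupp.degree_single] at hdeg
    omega
  refine ⟨mulLinForm k r d (Pi.single i 1) ⟨_, hm'⟩,
    Submodule.mem_iSup_of_mem _ ⟨_, rfl⟩, ?_⟩
  simp [linForm_single, X, monomial_mul]

theorem hilb_eq_finrank_quotient (I : Ideal (MvPolynomial (Fin r) k)) (d : ℕ) :
    hilb k r I d = finrank k (homogeneousSubmodule (Fin r) k d ⧸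
      (I.restrictScalars k).comap (homogeneousSubmodule (Fin r) k d).subtype) := by
  let f := (Ideal.Quotient.mkₐ k I).toLinearMap ∘ₗ (homogeneousSubmodule (Fin r) k d).subtype
  have hker : f.ker = (I.restrictScalars k).comap (homogeneousSubmodule (Fin r) k d).subtype := by
    ext p
    simp [f, Ideal.Quotient.eq_zero_iff_mem]
  rw [hilb, gradedPiece, ← hker, f.quotKerEquivRange.finrank_eq, LinearMap.range_comp,
    Submodule.range_subtype]

end HomogeneousPolynomials

/-- **Green's hyperplane restriction theorem** (Green, Theorem 1).
If `h_d = dim_k (R/I)_d`, then for a general linear form `L`, the degree-`d`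
entry of the Hilbert function of `R/(I+(L))` is at most `((h_d)_{(d)})⁻¹₀`. -/
theorem green_hyperplane_restriction
    (k : Type*) [Field k] [Infinite k] (r d : ℕ) (hd : 1 ≤ d)
    (I : Ideal (MvPolynomial (Fin r) k)) (hI : IsHomogIdeal I) :
    Generically k r (fun L =>
      hilb k r (I ⊔ Ideal.span {L}) d ≤ greenBound (hilb k r I d) d) := by
  obtain ⟨d, rfl⟩ := Nat.exists_eq_add_of_le' hd
  let W := (I.restrictScalars k).comap (homogeneousSubmodule (Fin r) k (d + 1)).subtype
  obtain ⟨c₀, hc₀⟩ := exists_finrank_quotient_sup_range_le (mulLinForm k r)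
    (fun d c c' p => Subtype.ext (mul_left_comm _ _ _)) iSup_range_mulLinForm d W
  obtain ⟨Q, hQ₀, hQ⟩ := exists_eval_ne_zero_and_finrank_quotient_le (mulLinForm k r d) W c₀
  refine ⟨Q, fun h => hQ₀ (by simp [h]), fun c hc => ?_⟩
  beta_reduce
  rw [hilb_eq_finrank_quotient, hilb_eq_finrank_quotient I]
  refine (finrank_quotient_anti ?_).trans ((hQ c hc).trans hc₀)
  refine sup_le (Submodule.comap_mono fun p hp => Submodule.mem_sup_left hp) ?_
  rintro _ ⟨p, rfl⟩
  exact Submodule.mem_sup_right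
    (Ideal.mul_mem_right _ _ (Ideal.subset_span (Set.mem_singleton _)))
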